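/- arXiv:1408.6858 — 2 statements merged into one kernel-verified Lean document; each statement's English description precedes it below -/
import Mathlib

section
/- If the binary expansion of the positive integer n has exactly three 1's (i.e. n is the sum of three distinct powers of 2), then (t+1)^2 = Φ_2(t)^2 divides the descent set polynomial Q_{2n}(t). -/
/-- The descent set of a permutation of `Fin n`, as a subset of `[n-1] = {1,…,n-1}`
(1-based positions): `i` is a descent if `π(i) > π(i+1)`. -/
def descentSet (n : ℕ) (π : Equiv.Perm (Fin n)) : Finset ℕ :=
  (Finset.Ico 1 n).filter fun i => ∀ h : i < n, π ⟨i, h⟩ < π ⟨i - 1, by omega⟩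

/-- The descent set statistic `β_n(S)`: the number of permutations of `{1,…,n}`
with descent set `S`. -/
def beta (n : ℕ) (S : Finset ℕ) : ℕ :=
  (Finset.univ.filter fun π : Equiv.Perm (Fin n) => descentSet n π = S).card

/-- The descent set polynomial `Q_n(t) = ∑_{S ⊆ [n-1]} t^{β_n(S)}`. -/
noncomputable def Q (n : ℕ) : Polynomial ℤ :=
  ∑ S ∈ (Finset.Ico 1 n).powerset, Polynomial.X ^ beta n S

namespace DescentSet

open Finset Polynomial

/-! ### Permutations increasing on the fibres of a monotone function -/

section Fibres

variable {n : ℕ} {β : Type*}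

/-- The Young subgroup of permutations preserving `f`. -/
def youngSubgroup (f : Fin n → β) : Subgroup (Equiv.Perm (Fin n)) where
  carrier := {h | f ∘ h = f}
  mul_mem' {g h} hg hh := by
    have hg' : f ∘ g = f := hg
    have hh' : f ∘ h = f := hh
    change f ∘ (g ∘ h) = f
    rw [← Function.comp_assoc, hg', hh']
  one_mem' := rfl
  inv_mem' {g} hg := by
    have hg' : f ∘ g = f := hg
    funext i
    simpa using (congrFun hg' (g⁻¹ i)).symm

lemma mem_youngSubgroup {f : Fin n → β} {h : Equiv.Perm (Fin n)} :
    h ∈ youngSubgroup f ↔ ∀ i, f (h i) = f i :=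
  funext_iff

variable [LinearOrder β]

/-- The permutations which are increasing on each fibre of `f`. -/
def increasingOn (f : Fin n → β) : Finset (Equiv.Perm (Fin n)) :=
  univ.filter fun π => ∀ i j, i < j → f i = f j → π i < π j

lemma eq_one_of_mem_increasingOn {f : Fin n → β} (hf : Monotone f) {σ h : Equiv.Perm (Fin n)}
    (hσ : σ ∈ increasingOn f) (hσh : σ * h ∈ increasingOn f) (hh : h ∈ youngSubgroup f) :
    h = 1 := by
  rw [mem_youngSubgroup] at hh
  simp only [increasingOn, mem_filter, mem_univ, true_and, Equiv.Perm.mul_apply] at hσ hσh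
  rw [← Equiv.Perm.monotone_iff]
  refine (?_ : StrictMono h).monotone
  intro i j hij
  by_contra hlt
  have hne : h j ≠ h i := fun e => hij.ne' (h.injective e)
  have hlt' : h j < h i := lt_of_le_of_ne (not_lt.1 hlt) hne
  have hfe : f (h j) = f (h i) := by
    apply le_antisymm (hf hlt'.le)
    rw [hh, hh]
    exact hf hij.le
  have h1 := hσ _ _ hlt' hfe
  have h2 := hσh i j hij (by rw [← hh i, ← hh j, hfe])
  exact lt_asymm h1 h2

lemma exists_mul_mem_increasingOn {f : Fin n → β} (hf : Monotone f) (π : Equiv.Perm (Fin n)) :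
    ∃ h ∈ youngSubgroup f, π * h ∈ increasingOn f := by
  let key : Fin n → β ×ₗ Fin n := fun i => toLex (f i, π i)
  have hmono : Monotone (key ∘ Tuple.sort key) := Tuple.monotone_sort key
  have hfs : f ∘ Tuple.sort key = f := by
    have h1 : Monotone (f ∘ Tuple.sort key) := fun i j hij => by
      rcases Prod.Lex.toLex_le_toLex.1 (hmono hij) with h | h
      · exact h.le
      · exact h.1.le
    exact Tuple.unique_monotone (τ := 1) h1 hf
  refine ⟨Tuple.sort key, hfs, ?_⟩
  simp only [increasingOn, mem_filter, mem_univ, true_and, Equiv.Perm.mul_apply]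
  intro i j hij hfij
  have hfs' : f (Tuple.sort key i) = f (Tuple.sort key j) := by
    have hi := congrFun hfs i
    have hj := congrFun hfs j
    simp only [Function.comp_apply] at hi hj
    rw [hi, hj, hfij]
  rcases (Prod.Lex.toLex_le_toLex.1 (hmono hij.le)) with h | h
  · exact absurd hfs' h.ne
  · refine lt_of_le_of_ne h.2 fun e => hij.ne ?_
    exact (Tuple.sort key).injective (π.injective e)

lemma card_increasingOn_mul {f : Fin n → β} (hf : Monotone f) :
    (increasingOn f).card * Nat.card (youngSubgroup f) = n.factorial := by
  have hb : Function.Bijective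
      (fun x : increasingOn f × youngSubgroup f => (x.1 : Equiv.Perm (Fin n)) * x.2) := by
    constructor
    · rintro ⟨⟨σ, hσ⟩, ⟨h, hh⟩⟩ ⟨⟨σ', hσ'⟩, ⟨h', hh'⟩⟩ e
      simp only at e
      have hσe : σ' = σ * (h * h'⁻¹) := by rw [← mul_assoc, e]; group
      have hk := eq_one_of_mem_increasingOn hf hσ (hσe ▸ hσ')
        (mul_mem hh (inv_mem hh'))
      have hhe : h = h' := mul_inv_eq_one.1 hk
      subst hhe
      have := mul_right_cancel e
      subst this
      rfl
    · intro π
      obtain ⟨h, hh, hπ⟩ := exists_mul_mem_increasingOn hf π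
      exact ⟨⟨⟨π * h, hπ⟩, ⟨h⁻¹, inv_mem hh⟩⟩, by simp⟩
  have := Nat.card_congr (Equiv.ofBijective _ hb)
  rw [Nat.card_prod] at this
  simpa [Nat.card_eq_fintype_card, Fintype.card_perm] using this

lemma card_youngSubgroup [Fintype β] (f : Fin n → β) :
    Nat.card (youngSubgroup f) = ∏ b, (Fintype.card {i // f i = b}).factorial := by
  rw [← DomMulAct.stabilizer_card f, ← Nat.card_eq_fintype_card]
  rfl

lemma descentSet_subset_iff {f : Fin n → β} (hf : Monotone f) {T : Finset ℕ}
    (hT : ∀ i (hi : i + 1 < n), f ⟨i, by omega⟩ = f ⟨i + 1, hi⟩ ↔ i + 1 ∉ T)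
    (π : Equiv.Perm (Fin n)) : descentSet n π ⊆ T ↔ π ∈ increasingOn f := by
  simp only [increasingOn, mem_filter, mem_univ, true_and]
  constructor
  · intro h
    have step : ∀ i (hi : i + 1 < n), f ⟨i, by omega⟩ = f ⟨i + 1, hi⟩ →
        π ⟨i, by omega⟩ < π ⟨i + 1, hi⟩ := by
      intro i hi he
      by_contra hlt
      refine (hT i hi).1 he (h ?_)
      simp only [descentSet, mem_filter, mem_Ico]
      refine ⟨⟨by omega, hi⟩, fun _ => lt_of_le_of_ne (not_lt.1 hlt) fun e => ?_⟩
      have := congrArg Fin.val (π.injective e)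
      simp at this
    rintro ⟨i, hi⟩ ⟨j, hj⟩ hij he
    simp only [Fin.mk_lt_mk] at hij
    induction j, hij using Nat.le_induction with
    | base => exact step i hj he
    | succ j hij ih =>
      have h1 : f ⟨i, hi⟩ = f ⟨j, by omega⟩ :=
        le_antisymm (hf (Fin.mk_le_mk.2 (by omega)))
          (he ▸ hf (Fin.mk_le_mk.2 (by omega)))
      exact (ih (by omega) h1).trans (step j hj (h1 ▸ he))
  · intro h p hp
    simp only [descentSet, mem_filter, mem_Ico] at hp
    obtain ⟨⟨hp1, hpn⟩, hd⟩ := hp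
    obtain ⟨i, rfl⟩ : ∃ i, p = i + 1 := ⟨p - 1, by omega⟩
    by_contra hpT
    have := h ⟨i, by omega⟩ ⟨i + 1, hpn⟩ (Fin.mk_lt_mk.2 (by omega)) ((hT i hpn).2 hpT)
    exact lt_asymm this (hd hpn)

end Fibres

/-! ### The number of permutations with descent set contained in a given set -/

/-- The number of permutations of `{1,…,n}` whose descent set is contained in `T`. -/
def alpha (n : ℕ) (T : Finset ℕ) : ℕ :=
  (univ.filter fun π : Equiv.Perm (Fin n) => descentSet n π ⊆ T).card

lemma alpha_mul_card {n : ℕ} {β : Type*} [LinearOrder β] {f : Fin n → β} (hf : Monotone f)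
    {T : Finset ℕ}
    (hT : ∀ i (hi : i + 1 < n), f ⟨i, by omega⟩ = f ⟨i + 1, hi⟩ ↔ i + 1 ∉ T) :
    alpha n T * Nat.card (youngSubgroup f) = n.factorial := by
  rw [← card_increasingOn_mul hf]
  have : (univ.filter fun π : Equiv.Perm (Fin n) => descentSet n π ⊆ T) = increasingOn f := by
    ext π
    simp [descentSet_subset_iff hf hT]
  rw [alpha, this]

/-- The index of the block of position `i` when cutting at the positions in `T`. -/
def block (n : ℕ) (T : Finset ℕ) (i : Fin n) : ℕ := (T.filter (· ≤ (i : ℕ))).card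

lemma monotone_block (n : ℕ) (T : Finset ℕ) : Monotone (block n T) := by
  intro i j hij
  exact card_le_card (monotone_filter_right T fun t _ ht => le_trans ht hij)

lemma block_eq_iff_of_le {n : ℕ} {T : Finset ℕ} {i j : Fin n} (hij : i ≤ j) :
    block n T i = block n T j ↔ ∀ t ∈ T, t ≤ (j : ℕ) → t ≤ (i : ℕ) := by
  have hsub : T.filter (· ≤ (i : ℕ)) ⊆ T.filter (· ≤ (j : ℕ)) :=
    monotone_filter_right T fun t _ ht => le_trans ht hij
  constructor
  · intro h t ht htj
    have := eq_of_subset_of_card_le hsub h.ge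
    have hm : t ∈ T.filter (· ≤ (i : ℕ)) := this ▸ mem_filter.2 ⟨ht, htj⟩
    exact (mem_filter.1 hm).2
  · intro h
    refine congrArg card (Subset.antisymm hsub fun t ht => ?_)
    rw [mem_filter] at ht ⊢
    exact ⟨ht.1, h t ht.1 ht.2⟩

lemma block_eq_of_subset {n : ℕ} {T T' : Finset ℕ} (h : T' ⊆ T) {i j : Fin n}
    (hij : block n T i = block n T j) : block n T' i = block n T' j := by
  rcases le_total i j with hle | hle
  · rw [block_eq_iff_of_le hle] at hij ⊢
    exact fun t ht => hij t (h ht)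
  · rw [eq_comm, block_eq_iff_of_le hle] at hij ⊢
    exact fun t ht => hij t (h ht)

lemma alpha_mul_card_block (n : ℕ) (T : Finset ℕ) :
    alpha n T * Nat.card (youngSubgroup (block n T)) = n.factorial := by
  refine alpha_mul_card (monotone_block n T) fun i hi => ?_
  rw [block_eq_iff_of_le (Fin.mk_le_mk.2 (by omega))]
  constructor
  · intro h hm
    have := h _ hm le_rfl
    simp at this
  · intro h t ht hti
    have : t ≠ i + 1 := fun e => h (e ▸ ht)
    simp only at hti ⊢
    omega

lemma alpha_dvd_alpha {n : ℕ} {T T' : Finset ℕ} (h : T' ⊆ T) : alpha n T' ∣ alpha n T := by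
  have hle : youngSubgroup (block n T) ≤ youngSubgroup (block n T') := by
    intro g hg
    rw [mem_youngSubgroup] at hg ⊢
    exact fun i => block_eq_of_subset h (hg i)
  obtain ⟨k, hk⟩ := Subgroup.card_dvd_of_le hle
  have h1 := alpha_mul_card_block n T
  have h2 := alpha_mul_card_block n T'
  have hpos : 0 < Nat.card (youngSubgroup (block n T)) := Nat.card_pos
  refine ⟨k, Nat.eq_of_mul_eq_mul_right hpos ?_⟩
  rw [h1, ← h2, hk]
  ring

lemma alpha_pair {n x y : ℕ} (hxy : x ≤ y) (hyn : y ≤ n) :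
    alpha n {x, y} = n.choose y * y.choose x := by
  let f : Fin n → Fin 3 := fun i => if (i : ℕ) < x then 0 else if (i : ℕ) < y then 1 else 2
  have hf : Monotone f := by
    intro i j hij
    have : (i : ℕ) ≤ j := hij
    simp only [f]
    split_ifs <;> omega
  have key := alpha_mul_card (T := {x, y}) hf (by
    intro i hi
    simp only [f, mem_insert, mem_singleton]
    split_ifs <;> simp <;> omega)
  have c0 : Fintype.card {i // f i = 0} = x := by
    rw [Fintype.card_subtype]
    have : (univ.filter fun i => f i = 0) = univ.filter fun i : Fin n => (i : ℕ) < x := by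
      ext i; simp only [f, mem_filter, mem_univ, true_and]; split_ifs <;> simp <;> omega
    rw [this, Fin.card_filter_val_lt]; omega
  have c01 : Fintype.card {i // f i = 0} + Fintype.card {i // f i = 1} = y := by
    rw [Fintype.card_subtype, Fintype.card_subtype, ← card_union_of_disjoint]
    · have : ((univ.filter fun i => f i = 0) ∪ univ.filter fun i => f i = 1) =
          univ.filter fun i : Fin n => (i : ℕ) < y := by
        ext i; simp only [f, mem_union, mem_filter, mem_univ, true_and]
        split_ifs <;> simp <;> omega
      rw [this, Fin.card_filter_val_lt]; omega
    · rw [disjoint_filter]; intro i _ h h'; rw [h] at h'; exact absurd h' (by decide)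
  have c012 : Fintype.card {i // f i = 0} + Fintype.card {i // f i = 1} +
      Fintype.card {i // f i = 2} = n := by
    have := Fintype.card_congr (Equiv.sigmaFiberEquiv f)
    rw [Fintype.card_sigma, Fin.sum_univ_three, Fintype.card_fin] at this
    exact this
  have c1 : Fintype.card {i // f i = 1} = y - x := by omega
  have c2 : Fintype.card {i // f i = 2} = n - y := by omega
  rw [card_youngSubgroup, Fin.prod_univ_three, c0, c1, c2] at key
  have h1 := Nat.choose_mul_factorial_mul_factorial hxy
  have h2 := Nat.choose_mul_factorial_mul_factorial hyn
  have hpos : 0 < x.factorial * (y - x).factorial * (n - y).factorial := by positivity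
  refine Nat.eq_of_mul_eq_mul_right hpos ?_
  rw [key, ← h2, ← h1]
  ring

lemma alpha_singleton {n x : ℕ} (hx : x ≤ n) : alpha n {x} = n.choose x := by
  simpa using alpha_pair (le_refl x) hx

lemma alpha_eq_sum_beta {n : ℕ} (S : Finset ℕ) :
    alpha n S = ∑ T ∈ S.powerset, beta n T := by
  unfold alpha beta
  rw [card_eq_sum_card_fiberwise (f := descentSet n) (t := S.powerset)]
  · refine sum_congr rfl fun T hT => congrArg card ?_
    ext π
    simp only [mem_filter, mem_univ, true_and, and_iff_right_iff_imp]
    rintro rfl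
    exact mem_powerset.1 hT
  · intro π hπ
    simpa using hπ

lemma beta_cast_eq_sum_alpha (n : ℕ) (S : Finset ℕ) :
    (beta n S : ZMod 2) = ∑ T ∈ S.powerset, (alpha n T : ZMod 2) := by
  simp only [alpha_eq_sum_beta, Nat.cast_sum]
  rw [sum_comm' (t' := S.powerset) (s' := fun U => Icc U S)]
  · rw [sum_eq_single S]
    · simp
    · intro U hU hne
      rw [sum_const, card_Icc_finset (mem_powerset.1 hU), nsmul_eq_mul]
      have hlt := card_lt_card (lt_of_le_of_ne (mem_powerset.1 hU) hne)
      have h2 : ((2 : ℕ) : ZMod 2) = 0 := ZMod.natCast_self 2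
      rw [Nat.cast_pow, h2, zero_pow (by omega), zero_mul]
    · simp
  · intro T U
    simp only [mem_powerset, mem_Icc]
    constructor
    · rintro ⟨h1, h2⟩; exact ⟨⟨h2, h1⟩, h2.trans h1⟩
    · rintro ⟨⟨h1, h2⟩, _⟩; exact ⟨h2, h1⟩

lemma neg_one_pow_beta (n : ℕ) (S : Finset ℕ) :
    (-1 : ℤ) ^ beta n S = (-1) ^ (S.powerset.filter fun T => Odd (alpha n T)).card := by
  rw [neg_one_pow_congr]
  rw [← ZMod.natCast_eq_zero_iff_even, ← ZMod.natCast_eq_zero_iff_even, beta_cast_eq_sum_alpha,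
    card_filter, Nat.cast_sum]
  refine Eq.congr (sum_congr rfl fun T _ => ?_) rfl
  split_ifs with h
  · rw [Nat.cast_one, ZMod.natCast_eq_one_iff_odd.2 h]
  · rw [Nat.cast_zero, ZMod.natCast_eq_zero_iff_even.2 (Nat.not_odd_iff_even.1 h)]

/-! ### Binary digits and the parity of binomial coefficients -/

lemma odd_choose_iff (n k : ℕ) :
    Odd (n.choose k) ↔ ∀ i, k.testBit i = true → n.testBit i = true := by
  induction n using Nat.strong_induction_on generalizing k with
  | _ n ih =>
    rcases Nat.eq_zero_or_pos n with rfl | hn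
    · rcases Nat.eq_zero_or_pos k with rfl | hk
      · simp
      · rw [Nat.choose_eq_zero_of_lt hk]
        obtain ⟨i, hi⟩ := Nat.exists_testBit_of_ne_zero hk.ne'
        simp only [Nat.not_odd_zero, false_iff]
        intro h
        simpa using h i hi
    · have hl : n.choose k ≡ (n % 2).choose (k % 2) * (n / 2).choose (k / 2) [MOD 2] :=
        Choose.choose_modEq_choose_mod_mul_choose_div_nat
      have h1 : Odd (n.choose k) ↔ Odd ((n % 2).choose (k % 2) * (n / 2).choose (k / 2)) := by
        rw [Nat.odd_iff, Nat.odd_iff, hl]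
      have h2 : Odd ((n % 2).choose (k % 2)) ↔ (k.testBit 0 = true → n.testBit 0 = true) := by
        rcases Nat.mod_two_eq_zero_or_one n with h | h <;>
        rcases Nat.mod_two_eq_zero_or_one k with h' | h' <;> simp [h, h']
      rw [h1, Nat.odd_mul, ih (n / 2) (by omega), h2]
      constructor
      · rintro ⟨h0, hs⟩ (_ | i)
        · exact h0
        · simpa [Nat.testBit_add_one] using hs i
      · intro h
        exact ⟨h 0, fun i => by simpa [Nat.testBit_add_one] using h (i + 1)⟩

/-- The sum of those among `2 ^ a`, `2 ^ b`, `2 ^ c` which are selected by `u`. -/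
def subsetSum (a b c : ℕ) (u : Bool × Bool × Bool) : ℕ :=
  (if u.1 then 2 ^ a else 0) ||| (if u.2.1 then 2 ^ b else 0) ||| (if u.2.2 then 2 ^ c else 0)

lemma testBit_subsetSum (a b c : ℕ) (u : Bool × Bool × Bool) (i : ℕ) :
    (subsetSum a b c u).testBit i = true ↔
      (u.1 = true ∧ a = i) ∨ (u.2.1 = true ∧ b = i) ∨ (u.2.2 = true ∧ c = i) := by
  obtain ⟨x, y, z⟩ := u
  cases x <;> cases y <;> cases z <;> simp [subsetSum, Nat.testBit_two_pow, or_assoc]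

section SubsetSum

variable {a b c : ℕ}

lemma subsetSum_top (hab : a < b) (hbc : b < c) :
    subsetSum a b c ⊤ = 2 ^ c + 2 ^ b + 2 ^ a := by
  have h1 : 2 ^ a < 2 ^ b := Nat.pow_lt_pow_right (by norm_num) hab
  have h2 : 2 ^ b ||| 2 ^ a < 2 ^ c :=
    Nat.or_lt_two_pow (Nat.pow_lt_pow_right (by norm_num) hbc)
      (Nat.pow_lt_pow_right (by norm_num) (hab.trans hbc))
  change 2 ^ a ||| 2 ^ b ||| 2 ^ c = _
  have e1 := Nat.two_pow_add_eq_or_of_lt h1 1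
  have e2 := Nat.two_pow_add_eq_or_of_lt h2 1
  rw [mul_one] at e1 e2
  rw [Nat.lor_comm, Nat.lor_comm (2 ^ a), ← e2, ← e1, add_assoc]

lemma odd_choose_subsetSum (hab : a < b) (hbc : b < c) (u v : Bool × Bool × Bool) :
    Odd ((subsetSum a b c v).choose (subsetSum a b c u)) ↔ u ≤ v := by
  have hac := hab.trans hbc
  simp only [odd_choose_iff, testBit_subsetSum, Prod.le_def, Bool.le_iff_imp]
  constructor
  · intro h
    refine ⟨fun hu => ?_, fun hu => ?_, fun hu => ?_⟩
    · simpa [hab.ne', hac.ne'] using h a (Or.inl ⟨hu, rfl⟩)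
    · simpa [hab.ne, hbc.ne'] using h b (Or.inr (Or.inl ⟨hu, rfl⟩))
    · simpa [hac.ne, hbc.ne] using h c (Or.inr (Or.inr ⟨hu, rfl⟩))
  · rintro ⟨h1, h2, h3⟩ i (⟨hu, rfl⟩ | ⟨hu, rfl⟩ | ⟨hu, rfl⟩)
    · exact Or.inl ⟨h1 hu, rfl⟩
    · exact Or.inr (Or.inl ⟨h2 hu, rfl⟩)
    · exact Or.inr (Or.inr ⟨h3 hu, rfl⟩)

lemma subsetSum_le_iff (hab : a < b) (hbc : b < c) {u v : Bool × Bool × Bool} (h : u ≤ v) :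
    subsetSum a b c u ≤ subsetSum a b c v := by
  by_contra hlt
  have := (odd_choose_subsetSum hab hbc u v).2 h
  rw [Nat.choose_eq_zero_of_lt (not_le.1 hlt)] at this
  simp at this

lemma subsetSum_injective (hab : a < b) (hbc : b < c) :
    Function.Injective (subsetSum a b c) := by
  intro u v h
  apply le_antisymm
  · rw [← odd_choose_subsetSum hab hbc, h]; simp
  · rw [← odd_choose_subsetSum hab hbc, h]; simp

lemma exists_eq_subsetSum {x : ℕ} (h : Odd ((subsetSum a b c ⊤).choose x)) :
    ∃ u, x = subsetSum a b c u := by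
  refine ⟨(x.testBit a, x.testBit b, x.testBit c), Nat.eq_of_testBit_eq fun i => ?_⟩
  rw [Bool.eq_iff_iff, testBit_subsetSum]
  rw [odd_choose_iff] at h
  constructor
  · intro hi
    have := (testBit_subsetSum a b c ⊤ i).1 (h i hi)
    rcases this with ⟨-, rfl⟩ | ⟨-, rfl⟩ | ⟨-, rfl⟩ <;> simp [hi]
  · rintro (⟨hu, rfl⟩ | ⟨hu, rfl⟩ | ⟨hu, rfl⟩) <;> exact hu

lemma even_subsetSum (ha : 0 < a) (hab : a < b) (hbc : b < c) (u : Bool × Bool × Bool) :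
    Even (subsetSum a b c u) := by
  rw [← Nat.not_odd_iff_even, Nat.odd_iff]
  intro h
  have h0 : (subsetSum a b c u).testBit 0 = true := by simp [h]
  rw [testBit_subsetSum] at h0
  omega

/-- A set of vertices of the Boolean lattice `B₃` which is a chain. -/
abbrev IsCubeChain (U : Finset (Bool × Bool × Bool)) : Prop :=
  ∀ u ∈ U, ∀ v ∈ U, u ≤ v ∨ v ≤ u

/-- The proper part of the Boolean lattice `B₃`. -/
def properCube : Finset (Bool × Bool × Bool) := univ.filter fun u => u ≠ ⊥ ∧ u ≠ ⊤

lemma card_le_two_of_isCubeChain :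
    ∀ U ∈ properCube.powerset, IsCubeChain U → U.card ≤ 2 := by
  decide +kernel

lemma sum_neg_one_pow_card_chains :
    ∑ A ∈ properCube.powerset, (-1 : ℤ) ^ (A.powerset.filter IsCubeChain).card = 0 := by
  decide +kernel

/-- The positions that control the parity of the descent set statistics. -/
def controlSet (a b c : ℕ) : Finset ℕ := properCube.image (subsetSum a b c)

lemma controlSet_subset (hab : a < b) (hbc : b < c) :
    controlSet a b c ⊆ Ico 1 (subsetSum a b c ⊤) := by
  intro x hx
  simp only [controlSet, mem_image, properCube, mem_filter, mem_univ, true_and] at hx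
  obtain ⟨u, ⟨h0, h1⟩, rfl⟩ := hx
  have hbot : subsetSum a b c ⊥ = 0 := by simp [subsetSum]
  have inj := subsetSum_injective hab hbc
  have g0 : subsetSum a b c u ≠ 0 := fun h => h0 (inj (h.trans hbot.symm))
  have g1 : subsetSum a b c u ≠ subsetSum a b c ⊤ := fun h => h1 (inj h)
  have g2 := subsetSum_le_iff hab hbc (le_top : u ≤ ⊤)
  rw [mem_Ico]
  omega

lemma odd_alpha_image_iff (hab : a < b) (hbc : b < c) {U : Finset (Bool × Bool × Bool)}
    (hU : U ⊆ properCube) :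
    Odd (alpha (subsetSum a b c ⊤) (U.image (subsetSum a b c))) ↔ IsCubeChain U := by
  have htop : ∀ u, subsetSum a b c u ≤ subsetSum a b c ⊤ := fun u =>
    subsetSum_le_iff hab hbc le_top
  have hpair : ∀ u v, u ≤ v →
      Odd (alpha (subsetSum a b c ⊤) {subsetSum a b c u, subsetSum a b c v}) := by
    intro u v huv
    rw [alpha_pair (subsetSum_le_iff hab hbc huv) (htop v), Nat.odd_mul,
      odd_choose_subsetSum hab hbc, odd_choose_subsetSum hab hbc]
    exact ⟨le_top, huv⟩
  constructor
  · intro h u hu v hv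
    have aux : ∀ u ∈ U, ∀ v ∈ U, subsetSum a b c u ≤ subsetSum a b c v → u ≤ v := by
      intro u hu v hv huv
      have hd : alpha (subsetSum a b c ⊤) {subsetSum a b c u, subsetSum a b c v} ∣
          alpha (subsetSum a b c ⊤) (U.image (subsetSum a b c)) := by
        apply alpha_dvd_alpha
        intro x hx
        rw [mem_insert, mem_singleton] at hx
        rcases hx with rfl | rfl
        · exact mem_image_of_mem _ hu
        · exact mem_image_of_mem _ hv
      have hodd := Odd.of_dvd_nat h hd
      rw [alpha_pair huv (htop v), Nat.odd_mul] at hodd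
      exact (odd_choose_subsetSum hab hbc u v).1 hodd.2
    rcases le_total (subsetSum a b c u) (subsetSum a b c v) with hle | hle
    · exact Or.inl (aux u hu v hv hle)
    · exact Or.inr (aux v hv u hu hle)
  · intro h
    have hcard := card_le_two_of_isCubeChain U (mem_powerset.2 hU) h
    interval_cases hc : U.card
    · rw [card_eq_zero] at hc
      subst hc
      exact Odd.of_dvd_nat (hpair ⊤ ⊤ le_rfl) (alpha_dvd_alpha (by simp))
    · obtain ⟨u, rfl⟩ := card_eq_one.1 hc
      simpa using hpair u u le_rfl
    · obtain ⟨u, v, -, rfl⟩ := card_eq_two.1 hc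
      rw [image_insert, image_singleton]
      rcases h u (by simp) v (by simp) with huv | huv
      · exact hpair u v huv
      · rw [pair_comm]
        exact hpair v u huv

lemma subset_controlSet_of_odd_alpha {T : Finset ℕ}
    (hT : T ⊆ Ico 1 (subsetSum a b c ⊤)) (h : Odd (alpha (subsetSum a b c ⊤) T)) :
    T ⊆ controlSet a b c := by
  intro x hx
  have hx' := mem_Ico.1 (hT hx)
  have hodd := Odd.of_dvd_nat h (alpha_dvd_alpha (singleton_subset_iff.2 hx))
  rw [alpha_singleton hx'.2.le] at hodd
  obtain ⟨u, rfl⟩ := exists_eq_subsetSum hodd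
  refine mem_image_of_mem _ (mem_filter.2 ⟨mem_univ _, ?_, ?_⟩)
  · rintro rfl
    exact absurd hx'.1 (by simp [subsetSum])
  · rintro rfl
    exact lt_irrefl _ hx'.2

lemma neg_one_pow_beta_eq_inter {S : Finset ℕ} (hS : S ⊆ Ico 1 (subsetSum a b c ⊤)) :
    (-1 : ℤ) ^ beta (subsetSum a b c ⊤) S =
      (-1) ^ beta (subsetSum a b c ⊤) (S ∩ controlSet a b c) := by
  rw [neg_one_pow_beta, neg_one_pow_beta]
  congr 2
  ext T
  simp only [mem_filter, mem_powerset, subset_inter_iff]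
  constructor
  · rintro ⟨h1, h2⟩
    exact ⟨⟨h1, subset_controlSet_of_odd_alpha (h1.trans hS) h2⟩, h2⟩
  · rintro ⟨⟨h1, -⟩, h2⟩
    exact ⟨h1, h2⟩

lemma sum_powerset_controlSet (hab : a < b) (hbc : b < c) :
    ∑ A ∈ (controlSet a b c).powerset, (-1 : ℤ) ^ beta (subsetSum a b c ⊤) A = 0 := by
  have inj := subsetSum_injective hab hbc
  have injI : Function.Injective (Finset.image (subsetSum a b c)) := image_injective inj
  rw [controlSet, powerset_image, sum_image injI.injOn, ← sum_neg_one_pow_card_chains]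
  refine sum_congr rfl fun A hA => ?_
  rw [neg_one_pow_beta, powerset_image, filter_image, card_image_of_injective _ injI]
  congr 2
  refine filter_congr fun U hU => ?_
  exact odd_alpha_image_iff hab hbc ((mem_powerset.1 hU).trans (mem_powerset.1 hA))

end SubsetSum

/-! ### Equidistribution of the descents at pairwise non-adjacent positions -/

lemma sum_comp_inter_eq_zero {ι : Type*} (s : Finset ι) (D : ι → Finset ℕ) (P : Finset ℕ)
    (tog : ℕ → ι → ι) (maps : ∀ p ∈ P, ∀ x ∈ s, tog p x ∈ s)
    (invol : ∀ p ∈ P, ∀ x ∈ s, tog p (tog p x) = x)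
    (htog : ∀ p ∈ P, ∀ x ∈ s, D (tog p x) ∩ P = symmDiff (D x ∩ P) {p})
    (w : Finset ℕ → ℤ) (hw : ∑ A ∈ P.powerset, w A = 0) :
    ∑ x ∈ s, w (D x ∩ P) = 0 := by
  have key : ∀ A : Finset ℕ, A ⊆ P →
      (s.filter fun x => D x ∩ P = A).card = (s.filter fun x => D x ∩ P = ∅).card := by
    intro A
    induction A using Finset.induction_on with
    | empty => intro _; rfl
    | insert p A hp ih =>
      intro hA
      have hpP : p ∈ P := hA (mem_insert_self p A)
      rw [← ih ((subset_insert p A).trans hA)]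
      have e1 : symmDiff (insert p A) {p} = A := by
        ext q; by_cases hq : q = p <;> simp [mem_symmDiff, hq, hp]
      have e2 : symmDiff A {p} = insert p A := by
        ext q; by_cases hq : q = p <;> simp [mem_symmDiff, hq, hp]
      refine card_nbij' (tog p) (tog p) ?_ ?_ ?_ ?_
      · intro x hx
        simp only [coe_filter, Set.mem_ofPred_eq] at hx ⊢
        exact ⟨maps p hpP x hx.1, by rw [htog p hpP x hx.1, hx.2, e1]⟩
      · intro x hx
        simp only [coe_filter, Set.mem_ofPred_eq] at hx ⊢
        exact ⟨maps p hpP x hx.1, by rw [htog p hpP x hx.1, hx.2, e2]⟩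
      · intro x hx
        exact invol p hpP x (mem_filter.1 hx).1
      · intro x hx
        exact invol p hpP x (mem_filter.1 hx).1
  rw [← sum_fiberwise_of_maps_to (t := P.powerset) (g := fun x => D x ∩ P)
    (fun x _ => mem_powerset.2 inter_subset_right)]
  have : ∀ A ∈ P.powerset, ∑ x ∈ s with D x ∩ P = A, w (D x ∩ P) =
      ((s.filter fun x => D x ∩ P = ∅).card : ℤ) * w A := by
    intro A hA
    rw [sum_congr rfl (g := fun _ => w A) (fun x hx => by rw [(mem_filter.1 hx).2]),
      sum_const, nsmul_eq_mul, key A (mem_powerset.1 hA)]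
  rw [sum_congr rfl this, ← mul_sum, hw, mul_zero]

lemma sum_subsets_eq_zero {n : ℕ} {P : Finset ℕ} (hP : P ⊆ Ico 1 n)
    (w : Finset ℕ → ℤ) (hw : ∑ A ∈ P.powerset, w A = 0) :
    ∑ S ∈ (Ico 1 n).powerset, w (S ∩ P) = 0 := by
  refine sum_comp_inter_eq_zero _ id P (fun p S => symmDiff S {p}) ?_ ?_ ?_ w hw
  · intro p hp S hS
    rw [mem_powerset] at hS ⊢
    intro q hq
    rw [mem_symmDiff, mem_singleton] at hq
    rcases hq with hq | hq
    · exact hS hq.1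
    · exact hq.1 ▸ hP hp
  · intro p _ S _
    exact symmDiff_symmDiff_cancel_right {p} S
  · intro p hp S _
    ext q
    by_cases hq : q = p
    · subst hq; simp [mem_symmDiff, hp]
    · simp [mem_symmDiff, hq]

lemma mem_descentSet {n p : ℕ} {π : Equiv.Perm (Fin n)} (hp : 1 ≤ p) (hpn : p < n) :
    p ∈ descentSet n π ↔ π ⟨p, hpn⟩ < π ⟨p - 1, by omega⟩ := by
  simp only [descentSet, mem_filter, mem_Ico]
  exact ⟨fun h => h.2 hpn, fun h => ⟨⟨hp, hpn⟩, fun _ => h⟩⟩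

/-- Exchange the values of a permutation at the (1-based) positions `p` and `p + 1`. -/
def exchange (n p : ℕ) (π : Equiv.Perm (Fin n)) : Equiv.Perm (Fin n) :=
  if h : p < n then π * Equiv.swap ⟨p, h⟩ ⟨p - 1, by omega⟩ else π

lemma exchange_exchange (n p : ℕ) (π : Equiv.Perm (Fin n)) :
    exchange n p (exchange n p π) = π := by
  unfold exchange
  split_ifs
  · rw [mul_assoc, Equiv.swap_mul_self, mul_one]
  · rfl

lemma descentSet_exchange_inter {n : ℕ} {P : Finset ℕ} (hP : P ⊆ Ico 1 n)
    (heven : ∀ p ∈ P, Even p) {p : ℕ} (hp : p ∈ P) (π : Equiv.Perm (Fin n)) :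
    descentSet n (exchange n p π) ∩ P = symmDiff (descentSet n π ∩ P) {p} := by
  obtain ⟨hp1, hpn⟩ := mem_Ico.1 (hP hp)
  ext q
  by_cases hq : q ∈ P
  · obtain ⟨hq1, hqn⟩ := mem_Ico.1 (hP hq)
    rw [mem_symmDiff, mem_inter, mem_inter, mem_singleton, mem_descentSet hq1 hqn,
      mem_descentSet hq1 hqn]
    simp only [exchange, hpn, dif_pos, Equiv.Perm.mul_apply]
    by_cases hqp : q = p
    · subst hqp
      rw [Equiv.swap_apply_left, Equiv.swap_apply_right]
      have hne : π ⟨q, hqn⟩ ≠ π ⟨q - 1, by omega⟩ := fun e => by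
        have := congrArg Fin.val (π.injective e)
        simp only at this
        omega
      simp only [hq, and_true, not_true_eq_false, and_false, true_and, false_or, not_lt]
      exact ⟨le_of_lt, fun h => lt_of_le_of_ne h hne.symm⟩
    · obtain ⟨k, hk⟩ := heven p hp
      obtain ⟨l, hl⟩ := heven q hq
      rw [Equiv.swap_apply_of_ne_of_ne, Equiv.swap_apply_of_ne_of_ne]
      · simp [hq, hqp]
      all_goals
        simp only [ne_eq, Fin.mk.injEq]
        omega
  · have : q ≠ p := fun e => hq (e ▸ hp)
    simp [mem_symmDiff, hq, this]

lemma sum_perm_eq_zero {n : ℕ} {P : Finset ℕ} (hP : P ⊆ Ico 1 n) (heven : ∀ p ∈ P, Even p)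
    (w : Finset ℕ → ℤ) (hw : ∑ A ∈ P.powerset, w A = 0) :
    ∑ π : Equiv.Perm (Fin n), w (descentSet n π ∩ P) = 0 :=
  sum_comp_inter_eq_zero univ (descentSet n) P (exchange n) (fun _ _ _ _ => mem_univ _)
    (fun p _ π _ => exchange_exchange n p π)
    (fun _ hp π _ => descentSet_exchange_inter hP heven hp π) w hw

/-! ### Double roots of the descent set polynomial -/

lemma sum_beta_mul (n : ℕ) (w : Finset ℕ → ℤ) :
    ∑ S ∈ (Ico 1 n).powerset, (beta n S : ℤ) * w S =
      ∑ π : Equiv.Perm (Fin n), w (descentSet n π) := by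
  rw [← sum_fiberwise_of_maps_to (s := univ) (t := (Ico 1 n).powerset) (g := descentSet n)
    (fun π _ => mem_powerset.2 (filter_subset _ _))]
  refine sum_congr rfl fun S _ => ?_
  rw [sum_congr rfl (g := fun _ => w S) (fun x hx => by rw [(mem_filter.1 hx).2]),
    sum_const, nsmul_eq_mul, beta]

lemma X_add_one_sq_dvd {p : ℤ[X]} (h0 : p.eval (-1) = 0) (h1 : (derivative p).eval (-1) = 0) :
    (X + 1) ^ 2 ∣ p := by
  rcases eq_or_ne p 0 with rfl | hp
  · exact dvd_zero _
  · have := (one_lt_rootMultiplicity_iff_isRoot hp).2 ⟨h0, h1⟩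
    simpa using (le_rootMultiplicity_iff hp).1 (Nat.succ_le_of_lt this)

lemma X_add_one_sq_dvd_Q {n : ℕ} {P : Finset ℕ} (hP : P ⊆ Ico 1 n) (heven : ∀ p ∈ P, Even p)
    (hpar : ∀ S ⊆ Ico 1 n, (-1 : ℤ) ^ beta n S = (-1) ^ beta n (S ∩ P))
    (hsum : ∑ A ∈ P.powerset, (-1 : ℤ) ^ beta n A = 0) :
    (X + 1) ^ 2 ∣ Q n := by
  apply X_add_one_sq_dvd
  · rw [Q, eval_finsetSum, ← sum_subsets_eq_zero hP _ hsum]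
    refine sum_congr rfl fun S hS => ?_
    rw [eval_pow, eval_X, hpar S (mem_powerset.1 hS)]
  · have h : ∑ S ∈ (Ico 1 n).powerset, (beta n S : ℤ) * (-1) ^ beta n S = 0 := by
      rw [sum_beta_mul n fun S => (-1) ^ beta n S, ← sum_perm_eq_zero hP heven _ hsum]
      exact sum_congr rfl fun π _ => hpar _ (filter_subset _ _)
    rw [Q, derivative_sum, eval_finsetSum, ← neg_eq_zero, ← sum_neg_distrib, ← h]
    refine sum_congr rfl fun S _ => ?_
    rw [derivative_X_pow]
    rcases Nat.eq_zero_or_eq_succ_pred (beta n S) with hb | hb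
    · simp [hb]
    · rw [hb]
      simp [pow_succ]

end DescentSet

/-- If the binary expansion of `n` has exactly three 1's, i.e.
`n = 2^c + 2^b + 2^a` with `c > b > a ≥ 0`, then `Φ₂(t)² = (t+1)²` divides
`Q_{2n}(t)`. -/
theorem cyclotomic_two_sq_dvd_three_ones (n a b c : ℕ) (hab : a < b) (hbc : b < c)
    (hn : n = 2 ^ c + 2 ^ b + 2 ^ a) :
    Polynomial.cyclotomic 2 ℤ ^ 2 ∣ Q (2 * n) := by
  have hab' : a + 1 < b + 1 := by omega
  have hbc' : b + 1 < c + 1 := by omega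
  have hN : 2 * n = DescentSet.subsetSum (a + 1) (b + 1) (c + 1) ⊤ := by
    rw [DescentSet.subsetSum_top hab' hbc', hn]
    ring
  rw [Polynomial.cyclotomic_two, hN]
  refine DescentSet.X_add_one_sq_dvd_Q (DescentSet.controlSet_subset hab' hbc') ?_
    (fun S hS => DescentSet.neg_one_pow_beta_eq_inter hS)
    (DescentSet.sum_powerset_controlSet hab' hbc')
  intro p hp
  obtain ⟨u, -, rfl⟩ := Finset.mem_image.1 hp
  exact DescentSet.even_subsetSum (by omega) hab' hbc' u
end

section
/- Let q = p^r be an odd prime power, where p is an odd prime and r ≥ 1. If ρ(q) = 1/2, then Φ_{2p}(t)^2 divides the descent set polynomial Q_{2q}(t); that is, the cyclotomic polynomial Φ_{2p} is a double factor of Q_{2q}(t). -/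
/-- The proportion of odd descent set statistics:
`ρ(n) = #{S ⊆ [n-1] : β_n(S) odd} / 2^{n-1}`. -/
def rho (n : ℕ) : ℚ :=
  ((Finset.Ico 1 n).powerset.filter fun S => Odd (beta n S)).card / 2 ^ (n - 1)

theorem mem_descentSet_iff {n : ℕ} (π : Equiv.Perm (Fin n)) {i : ℕ} (h1 : 1 ≤ i) (h : i < n) :
    i ∈ descentSet n π ↔ π ⟨i, h⟩ < π ⟨i - 1, by omega⟩ := by
  simp [descentSet, h1, h]

theorem descentSet_subset {n : ℕ} (π : Equiv.Perm (Fin n)) :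
    descentSet n π ⊆ Finset.Ico 1 n := Finset.filter_subset _ _

/-- The permutation of `Fin (e + k)` that places the elements of `A` in the first `e` positions
and the other ones in the last `k` positions, in the relative orders given by `σ` and `τ`. -/
def shuffle {e k : ℕ} (A : {A : Finset (Fin (e + k)) // A.card = e})
    (σ : Equiv.Perm (Fin e)) (τ : Equiv.Perm (Fin k)) : Equiv.Perm (Fin (e + k)) :=
  finSumFinEquiv.symm.trans ((Equiv.sumCongr σ τ).trans
    (finSumEquivOfFinset A.2 (by simp [Finset.card_compl, A.2])))

theorem shuffle_castAdd {e k : ℕ} (A : {A : Finset (Fin (e + k)) // A.card = e})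
    (σ : Equiv.Perm (Fin e)) (τ : Equiv.Perm (Fin k)) (i : Fin e) :
    shuffle A σ τ (Fin.castAdd k i) = A.1.orderEmbOfFin A.2 (σ i) := by
  simp [shuffle]

theorem shuffle_natAdd {e k : ℕ} (A : {A : Finset (Fin (e + k)) // A.card = e})
    (σ : Equiv.Perm (Fin e)) (τ : Equiv.Perm (Fin k)) (i : Fin k) :
    shuffle A σ τ (Fin.natAdd e i) =
      A.1ᶜ.orderEmbOfFin (by simp [Finset.card_compl, A.2]) (τ i) := by
  simp [shuffle]

theorem shuffle_bijective (e k : ℕ) : Function.Bijective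
    (fun x : {A : Finset (Fin (e + k)) // A.card = e} × Equiv.Perm (Fin e) × Equiv.Perm (Fin k) =>
      shuffle x.1 x.2.1 x.2.2) := by
  rw [Fintype.bijective_iff_injective_and_card]
  constructor
  · rintro ⟨A, σ, τ⟩ ⟨B, σ', τ'⟩ h
    simp only at h
    have hA : ∀ (C : {A : Finset (Fin (e + k)) // A.card = e}) (σ : Equiv.Perm (Fin e))
        (τ : Equiv.Perm (Fin k)),
        C.1 = Finset.univ.image fun i : Fin e => shuffle C σ τ (Fin.castAdd k i) := by
      intro C σ τ
      symm
      apply Finset.eq_of_subset_of_card_le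
      · intro x hx
        simp only [shuffle_castAdd, Finset.mem_image, Finset.mem_univ, true_and] at hx
        obtain ⟨i, rfl⟩ := hx
        exact Finset.orderEmbOfFin_mem _ _ _
      · rw [Finset.card_image_of_injective, C.2]
        · simp
        · exact (shuffle C σ τ).injective.comp (Fin.castAdd_injective e k)
    have hAB : A = B := Subtype.ext (by rw [hA A σ τ, hA B σ' τ', h])
    subst hAB
    have h1 : σ = σ' := by
      ext1 i
      have := congrArg (fun π => π (Fin.castAdd k i)) h
      simpa [shuffle_castAdd] using this
    have h2 : τ = τ' := by
      ext1 i
      have := congrArg (fun π => π (Fin.natAdd e i)) h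
      simpa [shuffle_natAdd] using this
    rw [h1, h2]
  · simp only [Fintype.card_prod, Fintype.card_finset_len, Fintype.card_perm, Fintype.card_fin]
    rw [← Nat.add_choose_mul_factorial_mul_factorial, ← mul_assoc, Nat.choose_symm_add]

theorem mem_descentSet_shuffle_left {e k : ℕ} (A : {A : Finset (Fin (e + k)) // A.card = e})
    (σ : Equiv.Perm (Fin e)) (τ : Equiv.Perm (Fin k)) {i : ℕ} (h1 : 1 ≤ i) (h : i < e) :
    i ∈ descentSet (e + k) (shuffle A σ τ) ↔ i ∈ descentSet e σ := by
  rw [mem_descentSet_iff _ h1 (by omega), mem_descentSet_iff _ h1 h]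
  have ha := shuffle_castAdd A σ τ ⟨i, h⟩
  have hb := shuffle_castAdd A σ τ ⟨i - 1, by omega⟩
  simp only [Fin.castAdd_mk] at ha hb
  rw [ha, hb, OrderEmbedding.lt_iff_lt]

theorem mem_descentSet_shuffle_right {e k : ℕ} (A : {A : Finset (Fin (e + k)) // A.card = e})
    (σ : Equiv.Perm (Fin e)) (τ : Equiv.Perm (Fin k)) {i : ℕ} (h1 : 1 ≤ i) (h : i < k) :
    e + i ∈ descentSet (e + k) (shuffle A σ τ) ↔ i ∈ descentSet k τ := by
  rw [mem_descentSet_iff _ (by omega) (by omega), mem_descentSet_iff _ h1 h]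
  have ha := shuffle_natAdd A σ τ ⟨i, h⟩
  have hb := shuffle_natAdd A σ τ ⟨i - 1, by omega⟩
  simp only [Fin.natAdd_mk] at ha hb
  have : e + i - 1 = e + (i - 1) := by omega
  simp only [this]
  rw [ha, hb, OrderEmbedding.lt_iff_lt]

theorem erase_descentSet_shuffle_eq_iff {e k : ℕ}
    (A : {A : Finset (Fin (e + k)) // A.card = e})
    (σ : Equiv.Perm (Fin e)) (τ : Equiv.Perm (Fin k)) {S : Finset ℕ}
    (hS : S ⊆ Finset.Ico 1 (e + k)) (heS : e ∉ S) :
    (descentSet (e + k) (shuffle A σ τ)).erase e = S ↔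
      descentSet e σ = S.filter (· < e) ∧
        descentSet k τ = (S.filter (e < ·)).image (· - e) := by
  constructor
  · rintro rfl
    constructor
    · ext i
      by_cases hi : 1 ≤ i ∧ i < e
      · have := mem_descentSet_shuffle_left A σ τ hi.1 hi.2
        simp [this, hi, hi.2.ne]
      · have h1 : i ∉ descentSet e σ := fun h => hi (by simpa using descentSet_subset _ h)
        simp only [h1, Finset.mem_filter, Finset.mem_erase, false_iff]
        rintro ⟨⟨_, h⟩, h'⟩
        have := descentSet_subset _ h
        simp only [Finset.mem_Ico] at this
        omega
    · ext i
      simp only [Finset.mem_image, Finset.mem_filter, Finset.mem_erase]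
      constructor
      · intro h
        have hi := descentSet_subset _ h
        simp only [Finset.mem_Ico] at hi
        exact ⟨e + i, ⟨⟨by omega, (mem_descentSet_shuffle_right A σ τ hi.1 hi.2).2 h⟩,
          by omega⟩, by omega⟩
      · rintro ⟨j, ⟨⟨_, h⟩, hj⟩, rfl⟩
        have hi := descentSet_subset _ h
        simp only [Finset.mem_Ico] at hi
        rw [← mem_descentSet_shuffle_right A σ τ (by omega) (by omega)]
        rwa [Nat.add_sub_cancel' hj.le]
  · rintro ⟨h1, h2⟩
    ext i
    rw [Finset.mem_erase]
    by_cases hi : 1 ≤ i ∧ i < e + k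
    · rcases lt_trichotomy i e with h | h | h
      · rw [mem_descentSet_shuffle_left A σ τ hi.1 h, h1]
        simp [h, h.ne]
      · simp [h, heS]
      · obtain ⟨j, rfl⟩ := Nat.exists_eq_add_of_lt h
        have := mem_descentSet_shuffle_right A σ τ (i := j + 1) (by omega) (by omega)
        rw [add_assoc, this, h2]
        simp only [Finset.mem_image, Finset.mem_filter]
        constructor
        · rintro ⟨_, l, ⟨hl, hl'⟩, hl2⟩
          have : l = e + (j + 1) := by omega
          exact this ▸ hl
        · intro hl
          exact ⟨by omega, _, ⟨hl, by omega⟩, by omega⟩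
    · have h3 : i ∉ S := fun h => hi (by simpa using hS h)
      have h4 : i ∉ descentSet (e + k) (shuffle A σ τ) :=
        fun h => hi (by simpa using descentSet_subset _ h)
      simp [h3, h4]

/-- Toggling one descent: the permutations whose descent set agrees with `S` away from `e` are
shuffles of a permutation of the first `e` positions and one of the other positions. -/
theorem beta_add_beta_insert {n e : ℕ} (hen : e ≤ n) {S : Finset ℕ}
    (hS : S ⊆ Finset.Ico 1 n) (heS : e ∉ S) :
    beta n S + beta n (insert e S) = n.choose e *
      (beta e (S.filter (· < e)) * beta (n - e) ((S.filter (e < ·)).image (· - e))) := by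
  obtain ⟨k, rfl⟩ := Nat.exists_eq_add_of_le hen
  rw [Nat.add_sub_cancel_left]
  have h1 : beta (e + k) S + beta (e + k) (insert e S) =
      (Finset.univ.filter fun π : Equiv.Perm (Fin (e + k)) =>
        (descentSet (e + k) π).erase e = S).card := by
    unfold beta
    rw [← Finset.card_union_of_disjoint]
    · congr 1
      ext π
      simp only [Finset.mem_union, Finset.mem_filter, Finset.mem_univ, true_and]
      constructor
      · rintro (h | h)
        · rw [h, Finset.erase_eq_of_notMem heS]
        · rw [h, Finset.erase_insert heS]
      · rintro rfl
        by_cases h : e ∈ descentSet (e + k) π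
        · right; rw [Finset.insert_erase h]
        · left; rw [Finset.erase_eq_of_notMem h]
    · rw [Finset.disjoint_filter]
      intro π _ h h'
      exact heS ((h.symm.trans h').symm ▸ Finset.mem_insert_self e S)
  have h2 : (Finset.univ.filter fun π : Equiv.Perm (Fin (e + k)) =>
        (descentSet (e + k) π).erase e = S).card =
      ((Finset.univ : Finset {A : Finset (Fin (e + k)) // A.card = e}) ×ˢ
        ((Finset.univ.filter fun σ : Equiv.Perm (Fin e) =>
          descentSet e σ = S.filter (· < e)) ×ˢ
        (Finset.univ.filter fun τ : Equiv.Perm (Fin k) =>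
          descentSet k τ = (S.filter (e < ·)).image (· - e)))).card := by
    symm
    apply Finset.card_bij fun x _ => shuffle x.1 x.2.1 x.2.2
    · rintro ⟨A, σ, τ⟩ hx
      simp only [Finset.mem_product, Finset.mem_filter, Finset.mem_univ, true_and] at hx ⊢
      exact (erase_descentSet_shuffle_eq_iff A σ τ hS heS).2 hx
    · intro x _ y _ h
      exact (shuffle_bijective e k).1 h
    · intro π hπ
      obtain ⟨⟨A, σ, τ⟩, rfl⟩ := (shuffle_bijective e k).2 π
      refine ⟨(A, σ, τ), ?_, rfl⟩
      simp only [Finset.mem_product, Finset.mem_filter, Finset.mem_univ, true_and] at hπ ⊢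
      exact (erase_descentSet_shuffle_eq_iff A σ τ hS heS).1 hπ
  rw [h1, h2, Finset.card_product, Finset.card_product, Finset.card_univ,
    Fintype.card_finset_len, Fintype.card_fin]
  rfl

theorem beta_empty (n : ℕ) : beta n ∅ = 1 := by
  unfold beta
  rw [Finset.card_eq_one]
  refine ⟨Equiv.refl _, ?_⟩
  ext π
  simp only [Finset.mem_filter, Finset.mem_univ, true_and, Finset.mem_singleton]
  constructor
  · intro h
    have hmono : StrictMono π := by
      rcases n with _ | n
      · intro i; exact i.elim0
      · rw [Fin.strictMono_iff_lt_succ]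
        intro i
        have hi : (i : ℕ) + 1 ∉ descentSet (n + 1) π := by simp [h]
        rw [mem_descentSet_iff _ (by omega) (by omega), not_lt] at hi
        exact lt_of_le_of_ne hi fun h => by simpa [Fin.ext_iff] using π.injective h
    have hid : ⇑π = id := by
      have := Subsingleton.elim (hmono.orderIsoOfSurjective π π.surjective) (OrderIso.refl (Fin n))
      exact congrArg DFunLike.coe this
    ext1 i
    exact congrFun hid i
  · rintro rfl
    ext i
    simp only [Finset.notMem_empty, iff_false]
    intro h
    have hi := descentSet_subset _ h
    simp only [Finset.mem_Ico] at hi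
    rw [mem_descentSet_iff _ hi.1 hi.2] at h
    simp [Fin.lt_def] at h
    omega

theorem choose_two_mul_modEq_of_odd (m : ℕ) {e : ℕ} (he : Odd e) :
    (2 * m).choose e ≡ 0 [MOD 2] := by
  have : Fact (Nat.Prime 2) := ⟨Nat.prime_two⟩
  have h := Choose.choose_modEq_choose_mod_mul_choose_div_nat (n := 2 * m) (k := e) (p := 2)
  rwa [Nat.mul_mod_right, Nat.odd_iff.1 he, Nat.choose_zero_succ, zero_mul] at h

theorem choose_mul_mul_modEq {p : ℕ} (hp : p.Prime) (m j : ℕ) :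
    (p * m).choose (p * j) ≡ m.choose j [MOD p] := by
  have : Fact p.Prime := ⟨hp⟩
  have h := Choose.choose_modEq_choose_mod_mul_choose_div_nat (n := p * m) (k := p * j) (p := p)
  rwa [Nat.mul_mod_right, Nat.mul_mod_right, Nat.choose_self, one_mul,
    Nat.mul_div_cancel_left _ hp.pos, Nat.mul_div_cancel_left _ hp.pos] at h

theorem choose_mul_modEq_of_not_dvd {p : ℕ} (hp : p.Prime) (m : ℕ) {e : ℕ} (he : ¬ p ∣ e) :
    (p * m).choose e ≡ 0 [MOD p] := by
  have : Fact p.Prime := ⟨hp⟩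
  have h := Choose.choose_modEq_choose_mod_mul_choose_div_nat (n := p * m) (k := e) (p := p)
  rwa [Nat.mul_mod_right, Nat.choose_eq_zero_of_lt
    (Nat.pos_of_ne_zero fun h => he (Nat.dvd_of_mod_eq_zero h)), zero_mul] at h

theorem choose_two_mul_prime_pow_modEq {p : ℕ} (hp : p.Prime) (r : ℕ) :
    (2 * p ^ r).choose (p ^ r) ≡ 2 [MOD p] := by
  induction r with
  | zero => rfl
  | succ r ih =>
    have h := choose_mul_mul_modEq hp (2 * p ^ r) (p ^ r)
    rw [show 2 * p ^ (r + 1) = p * (2 * p ^ r) by ring, pow_succ']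
    exact h.trans ih

theorem choose_two_mul_prime_pow_modEq_zero {p : ℕ} (hp : p.Prime) (r : ℕ) {e : ℕ}
    (h1 : 1 ≤ e) (h2 : e < 2 * p ^ r) (he : e ≠ p ^ r) :
    (2 * p ^ r).choose e ≡ 0 [MOD p] := by
  induction r generalizing e with
  | zero => simp at h2 he; omega
  | succ r ih =>
    rw [show 2 * p ^ (r + 1) = p * (2 * p ^ r) by ring] at h2 ⊢
    by_cases h : p ∣ e
    · obtain ⟨j, rfl⟩ := h
      refine (choose_mul_mul_modEq hp _ _).trans (ih ?_ ?_ ?_)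
      · exact Nat.pos_of_ne_zero fun h => by simp [h] at h1
      · exact lt_of_mul_lt_mul_left h2 (Nat.zero_le p)
      · rintro rfl
        exact he (pow_succ' p r).symm
    · exact choose_mul_modEq_of_not_dvd hp _ h

theorem beta_insert_odd {m e : ℕ} {S : Finset ℕ} (hS : S ⊆ Finset.Ico 1 (2 * m))
    (he : Odd e) (hem : e < 2 * m) (heS : e ∉ S) :
    (beta (2 * m) (insert e S) : ZMod 2) = beta (2 * m) S := by
  have h := congrArg (Nat.cast : ℕ → ZMod 2) (beta_add_beta_insert hem.le hS heS)
  have hc := (ZMod.natCast_eq_natCast_iff _ _ _).2 (choose_two_mul_modEq_of_odd m he)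
  push_cast at h hc
  rw [hc, zero_mul] at h
  rw [← sub_eq_zero, CharTwo.sub_eq_add, add_comm, h]

/-- Modulo 2, `β_{2m}(S)` only depends on the even elements of `S`. -/
theorem beta_filter_even {m : ℕ} {S : Finset ℕ} (hS : S ⊆ Finset.Ico 1 (2 * m)) :
    (beta (2 * m) (S.filter Even) : ZMod 2) = beta (2 * m) S := by
  have key : ∀ O : Finset ℕ, O ⊆ Finset.Ico 1 (2 * m) → (∀ e ∈ O, Odd e) →
      (beta (2 * m) (S.filter Even ∪ O) : ZMod 2) = beta (2 * m) (S.filter Even) := by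
    intro O hO hodd
    induction O using Finset.induction_on with
    | empty => simp
    | insert e O he ih =>
      have hO' := (Finset.subset_insert e O).trans hO
      have heodd := hodd e (Finset.mem_insert_self e O)
      rw [Finset.union_insert, beta_insert_odd
        (Finset.union_subset ((Finset.filter_subset _ _).trans hS) hO') heodd
        (Finset.mem_Ico.1 (hO (Finset.mem_insert_self e O))).2,
        ih hO' fun i hi => hodd i (Finset.mem_insert_of_mem hi)]
      simp [he, Nat.not_even_iff_odd.2 heodd]
  have h := key (S.filter (¬ Even ·)) ((Finset.filter_subset _ _).trans hS)
    fun e he => Nat.not_even_iff_odd.1 (Finset.mem_filter.1 he).2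
  rw [← h, Finset.filter_union_filter_not_eq]

/-- Modulo 2, doubling the descent set and the length does not change the statistic. -/
theorem beta_image_two_mul (m : ℕ) {T : Finset ℕ} (hT : T ⊆ Finset.Ico 1 m) :
    (beta (2 * m) (T.image (2 * ·)) : ZMod 2) = beta m T := by
  induction m using Nat.strong_induction_on generalizing T with
  | _ m IH =>
    induction T using Finset.induction_on with
    | empty => simp [beta_empty]
    | insert j T hj ih =>
      have hT' : T ⊆ Finset.Ico 1 m := (Finset.subset_insert j T).trans hT
      have hjm := Finset.mem_Ico.1 (hT (Finset.mem_insert_self j T))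
      have hinj : Function.Injective (fun i : ℕ => 2 * i) := fun a b h => by
        simp only at h; omega
      have hS : T.image (2 * ·) ⊆ Finset.Ico 1 (2 * m) := by
        intro x hx
        obtain ⟨i, hi, rfl⟩ := Finset.mem_image.1 hx
        have := Finset.mem_Ico.1 (hT' hi)
        simp only [Finset.mem_Ico]
        omega
      have hjS : 2 * j ∉ T.image (2 * ·) := by
        rw [Finset.mem_image]
        rintro ⟨i, hi, h⟩
        exact hj (hinj h ▸ hi)
      have h1 := congrArg (Nat.cast : ℕ → ZMod 2)
        (beta_add_beta_insert (n := 2 * m) (e := 2 * j) (by omega) hS hjS)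
      have h2 := congrArg (Nat.cast : ℕ → ZMod 2) (beta_add_beta_insert hjm.2.le hT' hj)
      have hc := (ZMod.natCast_eq_natCast_iff _ _ _).2 (choose_mul_mul_modEq Nat.prime_two m j)
      have e1 : (T.image (2 * ·)).filter (· < 2 * j) = (T.filter (· < j)).image (2 * ·) := by
        ext x
        simp only [Finset.mem_filter, Finset.mem_image]
        constructor
        · rintro ⟨⟨i, hi, rfl⟩, h⟩
          exact ⟨i, ⟨hi, by omega⟩, rfl⟩
        · rintro ⟨i, ⟨hi, h⟩, rfl⟩
          exact ⟨⟨i, hi, rfl⟩, by omega⟩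
      have e2 : ((T.image (2 * ·)).filter (2 * j < ·)).image (· - 2 * j) =
          ((T.filter (j < ·)).image (· - j)).image (2 * ·) := by
        ext x
        simp only [Finset.mem_filter, Finset.mem_image]
        constructor
        · rintro ⟨y, ⟨⟨i, hi, rfl⟩, h⟩, rfl⟩
          exact ⟨i - j, ⟨i, ⟨hi, by omega⟩, rfl⟩, by omega⟩
        · rintro ⟨y, ⟨i, ⟨hi, h⟩, rfl⟩, rfl⟩
          exact ⟨2 * i, ⟨⟨i, hi, rfl⟩, by omega⟩, by omega⟩
      have i1 := IH j hjm.2 (T := T.filter (· < j)) (by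
        intro x hx
        obtain ⟨hx, h⟩ := Finset.mem_filter.1 hx
        exact Finset.mem_Ico.2 ⟨(Finset.mem_Ico.1 (hT' hx)).1, h⟩)
      have i2 := IH (m - j) (by omega) (T := (T.filter (j < ·)).image (· - j)) (by
        intro x hx
        obtain ⟨y, hy, rfl⟩ := Finset.mem_image.1 hx
        obtain ⟨hy, h⟩ := Finset.mem_filter.1 hy
        have := Finset.mem_Ico.1 (hT' hy)
        simp only [Finset.mem_Ico]
        omega)
      rw [e1, e2, ← Nat.mul_sub] at h1
      push_cast at h1 h2
      rw [hc, i1, i2, ← h2, ih hT'] at h1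
      rw [Finset.image_insert]
      exact add_left_cancel h1

/-- Modulo `p`, `β_{2q}(S) = (-1)^{|S \ {q}|}` for a power `q` of the prime `p`. -/
theorem beta_two_mul_prime_pow {p : ℕ} (hp : p.Prime) (r : ℕ) {S : Finset ℕ}
    (hS : S ⊆ Finset.Ico 1 (2 * p ^ r)) :
    (beta (2 * p ^ r) S : ZMod p) = (-1) ^ (S.erase (p ^ r)).card := by
  have toggle : ∀ {e : ℕ} {S : Finset ℕ}, S ⊆ Finset.Ico 1 (2 * p ^ r) → e ∉ S → 1 ≤ e →
      e < 2 * p ^ r → e ≠ p ^ r →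
      (beta (2 * p ^ r) (insert e S) : ZMod p) = - beta (2 * p ^ r) S := by
    intro e S hS heS h1 h2 he
    have h := congrArg (Nat.cast : ℕ → ZMod p) (beta_add_beta_insert h2.le hS heS)
    have hc := (ZMod.natCast_eq_natCast_iff _ _ _).2
      (choose_two_mul_prime_pow_modEq_zero hp r h1 h2 he)
    push_cast at h hc
    rw [hc, zero_mul] at h
    exact eq_neg_of_add_eq_zero_right h
  have hq : 0 < p ^ r := pow_pos hp.pos r
  have single : (beta (2 * p ^ r) {p ^ r} : ZMod p) = 1 := by
    have h := congrArg (Nat.cast : ℕ → ZMod p) (beta_add_beta_insert (n := 2 * p ^ r)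
      (e := p ^ r) (S := ∅) (by omega) (by simp) (by simp))
    have hc := (ZMod.natCast_eq_natCast_iff _ _ _).2 (choose_two_mul_prime_pow_modEq hp r)
    push_cast at h hc
    rw [hc] at h
    simp only [beta_empty, insert_empty_eq, Finset.filter_empty, Finset.image_empty] at h
    linear_combination h
  have key : ∀ B O : Finset ℕ, B ⊆ {p ^ r} → O ⊆ (Finset.Ico 1 (2 * p ^ r)).erase (p ^ r) →
      (beta (2 * p ^ r) (B ∪ O) : ZMod p) = (-1) ^ O.card * beta (2 * p ^ r) B := by
    intro B O hB hO
    induction O using Finset.induction_on with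
    | empty => simp
    | insert e O he ih =>
      have hO' := (Finset.subset_insert e O).trans hO
      have hmem := hO (Finset.mem_insert_self e O)
      rw [Finset.mem_erase, Finset.mem_Ico] at hmem
      have heB : e ∉ B := fun h => hmem.1 (Finset.mem_singleton.1 (hB h))
      rw [Finset.union_insert, toggle (Finset.union_subset
        (hB.trans (Finset.singleton_subset_iff.2 (Finset.mem_Ico.2 ⟨hq, by omega⟩)))
        (hO'.trans (Finset.erase_subset _ _))) (by simp [he, heB])
        hmem.2.1 hmem.2.2 hmem.1, ih hO', Finset.card_insert_of_notMem he]
      ring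
  have hO := Finset.erase_subset_erase (p ^ r) hS
  by_cases hmem : p ^ r ∈ S
  · have h := key {p ^ r} (S.erase (p ^ r)) subset_rfl hO
    rwa [single, mul_one, Finset.singleton_union, Finset.insert_erase hmem] at h
  · have h := key ∅ (S.erase (p ^ r)) (Finset.empty_subset _) hO
    rw [beta_empty, Nat.cast_one, mul_one, Finset.empty_union] at h
    rwa [Finset.erase_eq_of_notMem hmem] at h ⊢

/-- The sign attached to position `i`: `-1` at a descent and `1` at an ascent. -/
def descentSign (i : ℕ) (S : Finset ℕ) : ℤ := if i ∈ S then -1 else 1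

theorem descentSign_mul_self (i : ℕ) (S : Finset ℕ) : descentSign i S * descentSign i S = 1 := by
  unfold descentSign; split_ifs <;> rfl

theorem prod_descentSign (U S : Finset ℕ) :
    ∏ i ∈ U, descentSign i S = (-1) ^ (U ∩ S).card := by
  simp_rw [descentSign, Finset.prod_ite, Finset.filter_mem_eq_inter]
  simp

/-- Reversal of the block of positions `a, …, b`. -/
def reverseBlock (n a b : ℕ) (hb : b < n) : Equiv.Perm (Fin n) where
  toFun i := if h : a ≤ i ∧ (i : ℕ) ≤ b then ⟨a + b - i, by omega⟩ else i
  invFun i := if h : a ≤ i ∧ (i : ℕ) ≤ b then ⟨a + b - i, by omega⟩ else i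
  left_inv i := by grind
  right_inv i := by grind

theorem reverseBlock_of_mem {n a b : ℕ} (hb : b < n) {i : ℕ} (h : a ≤ i ∧ i ≤ b) :
    reverseBlock n a b hb ⟨i, by omega⟩ = ⟨a + b - i, by omega⟩ := by
  simp [reverseBlock, h]

theorem reverseBlock_of_notMem {n a b : ℕ} (hb : b < n) {i : ℕ} (hi : i < n)
    (h : ¬ (a ≤ i ∧ i ≤ b)) :
    reverseBlock n a b hb ⟨i, hi⟩ = ⟨i, hi⟩ := by
  simp [reverseBlock, h]

/-- A product of descent signs over a set of positions with a maximal run of odd length sums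
to zero over all permutations. -/
theorem sum_prod_descentSign_eq_zero {n a b : ℕ} {U : Finset ℕ} (hU : U ⊆ Finset.Ico 1 n)
    (hb : b < n) (hrun : Finset.Ioc a b ⊆ U) (ha : a ∉ U) (hb' : b + 1 ∉ U)
    (hodd : Odd (b - a)) :
    ∑ π : Equiv.Perm (Fin n), ∏ i ∈ U, descentSign i (descentSet n π) = 0 := by
  set ρ := reverseBlock n a b hb with hρ
  have key : ∀ π : Equiv.Perm (Fin n),
      ∏ i ∈ U, descentSign i (descentSet n (π * ρ)) =
        - ∏ i ∈ U, descentSign i (descentSet n π) := by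
    intro π
    rw [← Finset.prod_sdiff hrun, ← Finset.prod_sdiff hrun, ← mul_neg]
    congr 1
    · refine Finset.prod_congr rfl fun i hi => ?_
      rw [Finset.mem_sdiff, Finset.mem_Ioc] at hi
      have hin := Finset.mem_Ico.1 (hU hi.1)
      have h1 : i ≠ a := fun h => ha (h ▸ hi.1)
      have h2 : i ≠ b + 1 := fun h => hb' (h ▸ hi.1)
      have : i ∈ descentSet n (π * ρ) ↔ i ∈ descentSet n π := by
        rw [mem_descentSet_iff _ hin.1 hin.2, mem_descentSet_iff _ hin.1 hin.2,
          Equiv.Perm.mul_apply, Equiv.Perm.mul_apply, hρ,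
          reverseBlock_of_notMem hb _ (by omega), reverseBlock_of_notMem hb _ (by omega)]
      simp [descentSign, this]
    · calc ∏ i ∈ Finset.Ioc a b, descentSign i (descentSet n (π * ρ))
          = ∏ i ∈ Finset.Ioc a b, (-1) * descentSign (a + b + 1 - i) (descentSet n π) := by
            refine Finset.prod_congr rfl fun i hi => ?_
            have hin := Finset.mem_Ico.1 (hU (hrun hi))
            rw [Finset.mem_Ioc] at hi
            have : i ∈ descentSet n (π * ρ) ↔ a + b + 1 - i ∉ descentSet n π := by
              rw [mem_descentSet_iff (π * ρ) hin.1 hin.2,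
                mem_descentSet_iff π (i := a + b + 1 - i) (by omega) (by omega),
                Equiv.Perm.mul_apply, Equiv.Perm.mul_apply, hρ,
                reverseBlock_of_mem hb (by omega), reverseBlock_of_mem hb (by omega)]
              have e1 : a + b - (i - 1) = a + b + 1 - i := by omega
              have e2 : a + b + 1 - i - 1 = a + b - i := by omega
              simp only [e1, e2, not_lt]
              refine ⟨le_of_lt, fun h => lt_of_le_of_ne h fun h => ?_⟩
              have := π.injective h
              simp only [Fin.mk.injEq] at this
              omega
            by_cases h : a + b + 1 - i ∈ descentSet n π <;> simp [descentSign, this, h]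
        _ = (-1) ^ (b - a) * ∏ i ∈ Finset.Ioc a b,
              descentSign (a + b + 1 - i) (descentSet n π) := by
            rw [Finset.prod_mul_distrib, Finset.prod_const, Nat.card_Ioc]
        _ = - ∏ i ∈ Finset.Ioc a b, descentSign i (descentSet n π) := by
            rw [hodd.neg_one_pow, neg_one_mul]
            congr 1
            refine Finset.prod_nbij' (a + b + 1 - ·) (a + b + 1 - ·) ?_ ?_ ?_ ?_ ?_ <;>
              simp only [Finset.mem_Ioc] <;> intros <;> first | omega | trivial
  have h := Equiv.sum_comp (Equiv.mulRight ρ)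
    fun π : Equiv.Perm (Fin n) => ∏ i ∈ U, descentSign i (descentSet n π)
  simp only [Equiv.coe_mulRight, key, Finset.sum_neg_distrib] at h
  linarith

theorem prod_one_add_descentSign {V E S : Finset ℕ} (hE : E ⊆ V) :
    ∏ i ∈ V, (1 + descentSign i E * descentSign i S) =
      if S ∩ V = E then 2 ^ V.card else 0 := by
  split_ifs with h
  · rw [Finset.prod_congr rfl (g := fun _ => (2 : ℤ)), Finset.prod_const]
    intro i hi
    have : i ∈ E ↔ i ∈ S := by simp [← h, hi]
    by_cases hS : i ∈ S <;> simp [descentSign, this, hS]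
  · obtain ⟨i, hi, hne⟩ : ∃ i ∈ V, ¬ (i ∈ E ↔ i ∈ S) := by
      by_contra! hcon
      apply h
      ext i
      rw [Finset.mem_inter]
      by_cases hi : i ∈ V
      · simp [hi, hcon i hi]
      · simpa [hi] using fun h => hi (hE h)
    refine Finset.prod_eq_zero hi ?_
    by_cases h1 : i ∈ E <;> by_cases h2 : i ∈ S <;> simp_all [descentSign]

/-- If a weight is orthogonal to all nonempty products of descent signs over subsets of `V`, then
it is orthogonal to every mean-zero function of the trace of the descent set on `V`. -/
theorem sum_mul_eq_zero_of_orthogonal {X : Type*} (s : Finset X) (D : X → Finset ℕ)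
    (V : Finset ℕ) (w : X → ℤ)
    (hw : ∀ A ⊆ V, A.Nonempty → ∑ x ∈ s, w x * ∏ i ∈ A, descentSign i (D x) = 0)
    (F : Finset ℕ → ℤ) (hF : ∑ E ∈ V.powerset, F E = 0) :
    ∑ x ∈ s, F (D x ∩ V) * w x = 0 := by
  have h2 : (2 : ℤ) ^ V.card ≠ 0 := by positivity
  apply mul_left_cancel₀ h2
  rw [mul_zero]
  have inner : ∀ E : Finset ℕ,
      ∑ x ∈ s, w x * ∏ i ∈ V, (1 + descentSign i E * descentSign i (D x)) = ∑ x ∈ s, w x := by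
    intro E
    simp_rw [Finset.prod_one_add, Finset.mul_sum]
    rw [Finset.sum_comm, Finset.sum_eq_single_of_mem ∅ (Finset.empty_mem_powerset V)]
    · simp
    · intro A hA hne
      simp_rw [Finset.prod_mul_distrib, mul_left_comm (w _)]
      rw [← Finset.mul_sum, hw A (Finset.mem_powerset.1 hA) (Finset.nonempty_iff_ne_empty.2 hne),
        mul_zero]
  calc (2 : ℤ) ^ V.card * ∑ x ∈ s, F (D x ∩ V) * w x
      = ∑ x ∈ s, ∑ E ∈ V.powerset, F E *
          (w x * ∏ i ∈ V, (1 + descentSign i E * descentSign i (D x))) := by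
        rw [Finset.mul_sum]
        refine Finset.sum_congr rfl fun x _ => ?_
        rw [Finset.sum_eq_single_of_mem (D x ∩ V)
          (Finset.mem_powerset.2 Finset.inter_subset_right)]
        · rw [prod_one_add_descentSign Finset.inter_subset_right, if_pos rfl]
          ring
        · intro E hE hne
          rw [prod_one_add_descentSign (Finset.mem_powerset.1 hE), if_neg hne.symm]
          ring
    _ = 0 := by
        rw [Finset.sum_comm]
        simp_rw [← Finset.mul_sum, inner]
        rw [← Finset.sum_mul, hF, zero_mul]

theorem prod_mul_prod_descentSign {A W : Finset ℕ} (hA : A ⊆ W) (S : Finset ℕ) :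
    (∏ i ∈ W, descentSign i S) * ∏ i ∈ A, descentSign i S = ∏ i ∈ W \ A, descentSign i S := by
  rw [← Finset.prod_sdiff hA, mul_assoc, ← Finset.prod_mul_distrib]
  simp [descentSign_mul_self]

theorem sum_powerset_prod_descentSign {U W : Finset ℕ} (hU : U ⊆ W) (hne : U.Nonempty) :
    ∑ S ∈ W.powerset, ∏ i ∈ U, descentSign i S = 0 := by
  obtain ⟨u, hu⟩ := hne
  rw [← Finset.insert_erase (hU hu), Finset.sum_powerset_insert (Finset.notMem_erase u W),
    ← Finset.sum_add_distrib]
  refine Finset.sum_eq_zero fun S hS => ?_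
  have huS : u ∉ S := fun h => Finset.notMem_erase u W (Finset.mem_powerset.1 hS h)
  have h : ∏ i ∈ U.erase u, descentSign i (insert u S) = ∏ i ∈ U.erase u, descentSign i S :=
    Finset.prod_congr rfl fun i hi => by
      simp [descentSign, Finset.ne_of_mem_erase hi]
  rw [← Finset.mul_prod_erase U _ hu, ← Finset.mul_prod_erase U _ hu, h]
  simp [descentSign, huS]

theorem sum_beta_mul (n : ℕ) (g : Finset ℕ → ℤ) :
    ∑ S ∈ (Finset.Ico 1 n).powerset, g S * beta n S =
      ∑ π : Equiv.Perm (Fin n), g (descentSet n π) := by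
  rw [← Finset.sum_fiberwise_of_maps_to (s := Finset.univ) (t := (Finset.Ico 1 n).powerset)
    (g := descentSet n) fun π _ => Finset.mem_powerset.2 (descentSet_subset π)]
  refine Finset.sum_congr rfl fun S _ => ?_
  rw [Finset.sum_congr rfl (g := fun _ => g S), Finset.sum_const, nsmul_eq_mul, mul_comm]
  · rfl
  · intro π hπ
    rw [(Finset.mem_filter.1 hπ).2]

theorem sum_prod_descentSign_even {n : ℕ} {A : Finset ℕ}
    (hA : A ⊆ (Finset.Ico 1 n).filter Even) (hne : A.Nonempty) :
    ∑ π : Equiv.Perm (Fin n), ∏ i ∈ A, descentSign i (descentSet n π) = 0 := by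
  have hA' : ∀ i ∈ A, (1 ≤ i ∧ i < n) ∧ Even i := fun i hi => by simpa using hA hi
  obtain ⟨e, he⟩ := hne
  obtain ⟨⟨h1, h2⟩, h3⟩ := hA' e he
  refine sum_prod_descentSign_eq_zero (a := e - 1) (b := e)
    (hA.trans (Finset.filter_subset _ _)) h2 ?_ ?_ ?_ ?_
  · intro i hi
    rw [Finset.mem_Ioc] at hi
    rwa [show i = e by omega]
  · intro h
    have := (hA' _ h).2
    grind
  · intro h
    have := (hA' _ h).2
    grind
  · rw [show e - (e - 1) = 1 by omega]
    exact odd_one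

theorem sum_prod_descentSign_sdiff_even {q : ℕ} (hq : Odd q) {A : Finset ℕ}
    (hA : A ⊆ (Finset.Ico 1 (2 * q)).filter Even) (hne : A.Nonempty) :
    ∑ π : Equiv.Perm (Fin (2 * q)),
      ∏ i ∈ (Finset.Ico 1 (2 * q)).erase q \ A, descentSign i (descentSet (2 * q) π) = 0 := by
  have hA' : ∀ i ∈ A, (1 ≤ i ∧ i < 2 * q) ∧ Even i := fun i hi => by simpa using hA hi
  have hsub : (Finset.Ico 1 (2 * q)).erase q \ A ⊆ Finset.Ico 1 (2 * q) :=
    Finset.sdiff_subset.trans (Finset.erase_subset _ _)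
  have hmin := hA' _ (A.min'_mem hne)
  have hmax := hA' _ (A.max'_mem hne)
  by_cases h : A.min' hne < q
  · refine sum_prod_descentSign_eq_zero (a := 0) (b := A.min' hne - 1) hsub (by omega)
      ?_ ?_ ?_ (by grind)
    · intro i hi
      rw [Finset.mem_Ioc] at hi
      rw [Finset.mem_sdiff, Finset.mem_erase, Finset.mem_Ico]
      refine ⟨⟨by omega, by omega, by omega⟩, fun hiA => ?_⟩
      have := A.min'_le i hiA
      omega
    · simp
    · rw [Nat.sub_add_cancel hmin.1.1]
      exact fun h => (Finset.mem_sdiff.1 h).2 (A.min'_mem hne)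
  · have hle := A.min'_le _ (A.max'_mem hne)
    have hneq : A.max' hne ≠ q := fun h => by
      have := hmax.2
      rw [h] at this
      exact Nat.not_even_iff_odd.2 hq this
    refine sum_prod_descentSign_eq_zero (a := A.max' hne) (b := 2 * q - 1) hsub (by omega)
      ?_ ?_ ?_ (by grind)
    · intro i hi
      rw [Finset.mem_Ioc] at hi
      rw [Finset.mem_sdiff, Finset.mem_erase, Finset.mem_Ico]
      refine ⟨⟨by omega, by omega, by omega⟩, fun hiA => ?_⟩
      have := A.le_max' i hiA
      omega
    · exact fun h => (Finset.mem_sdiff.1 h).2 (A.max'_mem hne)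
    · intro h
      have := Finset.mem_Ico.1 (hsub h)
      omega

theorem neg_one_pow_eq_of_zmod_two {a b : ℕ} (h : (a : ZMod 2) = b) :
    (-1 : ℤ) ^ a = (-1) ^ b := by
  rw [ZMod.natCast_eq_natCast_iff, Nat.ModEq] at h
  rw [neg_one_pow_eq_pow_mod_two, h, ← neg_one_pow_eq_pow_mod_two]

theorem sum_neg_one_pow_beta_of_rho {q : ℕ} (h : rho q = 1 / 2) :
    ∑ T ∈ (Finset.Ico 1 q).powerset, (-1 : ℤ) ^ beta q T = 0 := by
  have hcard : 2 * ((Finset.Ico 1 q).powerset.filter fun S => Odd (beta q S)).card =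
      2 ^ (q - 1) := by
    unfold rho at h
    rw [div_eq_div_iff (by positivity) (by norm_num)] at h
    have : (2 * ((Finset.Ico 1 q).powerset.filter fun S => Odd (beta q S)).card : ℚ) =
      2 ^ (q - 1) := by linarith
    exact_mod_cast this
  have hterm : ∀ T : Finset ℕ, (-1 : ℤ) ^ beta q T = 1 - 2 * (if Odd (beta q T) then 1 else 0) := by
    intro T
    split_ifs with h
    · rw [h.neg_one_pow]; norm_num
    · rw [(Nat.not_odd_iff_even.1 h).neg_one_pow]; norm_num
  simp_rw [hterm]
  rw [Finset.sum_sub_distrib, ← Finset.mul_sum, Finset.sum_boole, Finset.sum_const,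
    Finset.card_powerset, Nat.card_Ico, ← hcard]
  simp

theorem sum_neg_one_pow_beta_two_mul (q : ℕ) :
    ∑ E ∈ ((Finset.Ico 1 (2 * q)).filter Even).powerset, (-1 : ℤ) ^ beta (2 * q) E =
      ∑ T ∈ (Finset.Ico 1 q).powerset, (-1 : ℤ) ^ beta q T := by
  have himg : (Finset.Ico 1 (2 * q)).filter Even = (Finset.Ico 1 q).image (2 * ·) := by
    ext i
    simp only [Finset.mem_filter, Finset.mem_Ico, Finset.mem_image]
    constructor
    · rintro ⟨⟨h1, h2⟩, j, rfl⟩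
      exact ⟨j, ⟨by omega, by omega⟩, by omega⟩
    · rintro ⟨j, ⟨h1, h2⟩, rfl⟩
      exact ⟨⟨by omega, by omega⟩, even_two_mul j⟩
  have hinj : Function.Injective (fun i : ℕ => 2 * i) := fun a b h => by
    simp only at h; omega
  rw [himg, Finset.powerset_image, Finset.sum_image (Finset.image_injective hinj).injOn]
  refine Finset.sum_congr rfl fun T hT => ?_
  exact neg_one_pow_eq_of_zmod_two (beta_image_two_mul q (Finset.mem_powerset.1 hT))

theorem pow_beta_eq {p : ℕ} (hp : p.Prime) (hpodd : Odd p) (r : ℕ) {ζ : ℂ}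
    (hζ : ζ ^ p = -1) {S : Finset ℕ} (hS : S ⊆ Finset.Ico 1 (2 * p ^ r)) :
    ζ ^ beta (2 * p ^ r) S =
      ((-1 : ℤ) ^ beta (2 * p ^ r) (S ∩ (Finset.Ico 1 (2 * p ^ r)).filter Even) : ℤ) *
        ((-ζ + (-ζ)⁻¹) / 2 + (-ζ - (-ζ)⁻¹) / 2 *
          (∏ i ∈ (Finset.Ico 1 (2 * p ^ r)).erase (p ^ r), descentSign i S : ℤ)) := by
  have hη : (-ζ) ^ p = 1 := by rw [hpodd.neg_pow, hζ, neg_neg]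
  have hV : S ∩ (Finset.Ico 1 (2 * p ^ r)).filter Even = S.filter Even := by
    rw [Finset.inter_filter, Finset.inter_eq_left.2 hS]
  have hU : (Finset.Ico 1 (2 * p ^ r)).erase (p ^ r) ∩ S = S.erase (p ^ r) := by
    rw [Finset.erase_inter, Finset.inter_eq_right.2 hS]
  have hβ := beta_two_mul_prime_pow hp r hS
  rw [hV, neg_one_pow_eq_of_zmod_two (beta_filter_even hS), prod_descentSign, hU]
  have hsplit : ζ ^ beta (2 * p ^ r) S =
      (-1) ^ beta (2 * p ^ r) S * (-ζ) ^ beta (2 * p ^ r) S := by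
    rw [← mul_pow]; simp
  rw [hsplit]
  push_cast
  congr 1
  rcases Nat.even_or_odd (S.erase (p ^ r)).card with h | h
  · rw [h.neg_one_pow] at hβ ⊢
    have h1 : beta (2 * p ^ r) S ≡ 1 [MOD p] :=
      (ZMod.natCast_eq_natCast_iff _ _ _).1 (by simpa using hβ)
    rw [pow_eq_pow_mod _ hη, h1, ← pow_eq_pow_mod _ hη]
    ring
  · rw [h.neg_one_pow] at hβ ⊢
    have h1 : p ∣ beta (2 * p ^ r) S + 1 :=
      (ZMod.natCast_eq_zero_iff _ _).1 (by simp [hβ])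
    obtain ⟨k, hk⟩ := h1
    have h2 : (-ζ) ^ beta (2 * p ^ r) S * (-ζ) = 1 := by
      rw [← pow_succ, hk, pow_mul, hη, one_pow]
    rw [eq_inv_of_mul_eq_one_left h2]
    ring

theorem cyclotomic_sq_dvd {n : ℕ} (hn : 0 < n) {ζ : ℂ} (hζ : IsPrimitiveRoot ζ n)
    {P : Polynomial ℤ} (h0 : Polynomial.aeval ζ P = 0)
    (h1 : Polynomial.aeval ζ (Polynomial.derivative P) = 0) :
    Polynomial.cyclotomic n ℤ ^ 2 ∣ P := by
  have hdvd : ∀ R : Polynomial ℤ, Polynomial.aeval ζ R = 0 → Polynomial.cyclotomic n ℤ ∣ R := by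
    intro R hR
    rw [Polynomial.cyclotomic_eq_minpoly hζ hn]
    exact minpoly.isIntegrallyClosed_dvd (hζ.isIntegral hn) hR
  have hroot : Polynomial.aeval ζ (Polynomial.cyclotomic n ℤ) = 0 := by
    rw [Polynomial.cyclotomic_eq_minpoly hζ hn]
    exact minpoly.aeval _ _
  have : NeZero (n : ℂ) := ⟨by exact_mod_cast hn.ne'⟩
  have hsep : Polynomial.aeval ζ (Polynomial.derivative (Polynomial.cyclotomic n ℤ)) ≠ 0 := by
    have h := (Polynomial.separable_cyclotomic n ℂ).aeval_derivative_ne_zero (x := ζ)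
    rw [← Polynomial.map_cyclotomic_int n ℂ, Polynomial.derivative_map] at h
    rw [← algebraMap_int_eq, Polynomial.aeval_map_algebraMap,
      Polynomial.aeval_map_algebraMap] at h
    exact h hroot
  obtain ⟨R, rfl⟩ := hdvd P h0
  rw [Polynomial.derivative_mul, map_add, map_mul, map_mul, hroot, zero_mul, add_zero] at h1
  rw [sq]
  exact mul_dvd_mul_left _ (hdvd R ((mul_eq_zero.1 h1).resolve_left hsep))

/-- For an odd prime power `q = p^r` with `ρ(q) = 1/2`, the cyclotomic
polynomial `Φ_{2p}` is a double factor of `Q_{2q}(t)`. -/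
theorem cyclotomic_two_p_sq_dvd (p r : ℕ) (hp : p.Prime) (hpodd : Odd p) (hr : 1 ≤ r)
    (hrho : rho (p ^ r) = 1 / 2) :
    Polynomial.cyclotomic (2 * p) ℤ ^ 2 ∣ Q (2 * p ^ r) := by
  have hq : Odd (p ^ r) := hpodd.pow
  have hq1 : 1 < p ^ r := Nat.one_lt_pow (by omega) hp.one_lt
  set q := p ^ r with hq_def
  set W := (Finset.Ico 1 (2 * q)).erase q with hW
  set V := (Finset.Ico 1 (2 * q)).filter Even with hV
  have hVW : V ⊆ W := fun i hi => by
    rw [hV, Finset.mem_filter] at hi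
    refine Finset.mem_erase.2 ⟨?_, hi.1⟩
    rintro rfl
    exact Nat.not_even_iff_odd.2 hq hi.2
  set F : Finset ℕ → ℤ := fun E => (-1) ^ beta (2 * q) E with hFdef
  have hF : ∑ E ∈ V.powerset, F E = 0 := by
    rw [hFdef, hV, sum_neg_one_pow_beta_two_mul, sum_neg_one_pow_beta_of_rho hrho]
  have s1 : ∑ S ∈ (Finset.Ico 1 (2 * q)).powerset, F (S ∩ V) = 0 := by
    simpa using sum_mul_eq_zero_of_orthogonal _ id V (fun _ => 1) (fun A hA hne => by
      simpa using sum_powerset_prod_descentSign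
        (hA.trans (Finset.filter_subset _ _)) hne) F hF
  have s2 : ∑ S ∈ (Finset.Ico 1 (2 * q)).powerset,
      F (S ∩ V) * ∏ i ∈ W, descentSign i S = 0 := by
    refine sum_mul_eq_zero_of_orthogonal _ id V _ (fun A hA _ => ?_) F hF
    simp_rw [id, prod_mul_prod_descentSign (hA.trans hVW)]
    refine sum_powerset_prod_descentSign
      (Finset.sdiff_subset.trans (Finset.erase_subset _ _)) ⟨1, ?_⟩
    have h1A : 1 ∉ A := fun h => by simpa [hV] using hA h
    simp only [hW, Finset.mem_sdiff, Finset.mem_erase, Finset.mem_Ico]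
    exact ⟨⟨by omega, by omega, by omega⟩, h1A⟩
  have s3 : ∑ S ∈ (Finset.Ico 1 (2 * q)).powerset, F (S ∩ V) * beta (2 * q) S = 0 := by
    rw [sum_beta_mul (2 * q) fun S => F (S ∩ V)]
    simpa using sum_mul_eq_zero_of_orthogonal Finset.univ (descentSet (2 * q)) V (fun _ => 1)
      (fun A hA hne => by simpa using sum_prod_descentSign_even hA hne) F hF
  have s4 : ∑ S ∈ (Finset.Ico 1 (2 * q)).powerset,
      (F (S ∩ V) * ∏ i ∈ W, descentSign i S) * beta (2 * q) S = 0 := by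
    rw [sum_beta_mul (2 * q) fun S => F (S ∩ V) * ∏ i ∈ W, descentSign i S]
    refine sum_mul_eq_zero_of_orthogonal Finset.univ (descentSet (2 * q)) V _
      (fun A hA hne => ?_) F hF
    simp_rw [prod_mul_prod_descentSign (hA.trans hVW)]
    exact sum_prod_descentSign_sdiff_even hq hA hne
  have hpos : 0 < 2 * p := Nat.mul_pos two_pos hp.pos
  have hprim := Complex.isPrimitiveRoot_exp (2 * p) hpos.ne'
  set ζ := Complex.exp (2 * Real.pi * Complex.I / (2 * p : ℕ))
  have hζ : ζ ^ p = -1 := (hprim.pow hpos (mul_comm 2 p)).eq_neg_one_of_two_right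
  obtain ⟨c, d, hcd⟩ : ∃ c d : ℂ, ∀ S ⊆ Finset.Ico 1 (2 * q),
      ζ ^ beta (2 * q) S = (F (S ∩ V) : ℂ) * (c + d * (∏ i ∈ W, descentSign i S : ℤ)) :=
    ⟨_, _, fun S hS => pow_beta_eq hp hpodd r hζ hS⟩
  refine cyclotomic_sq_dvd hpos hprim ?_ ?_
  · have t1 := congrArg (Int.cast : ℤ → ℂ) s1
    have t2 := congrArg (Int.cast : ℤ → ℂ) s2
    rw [Int.cast_sum, Int.cast_zero] at t1 t2
    calc Polynomial.aeval ζ (Q (2 * q))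
        = ∑ S ∈ (Finset.Ico 1 (2 * q)).powerset, ζ ^ beta (2 * q) S := by simp [Q]
      _ = c * ∑ S ∈ (Finset.Ico 1 (2 * q)).powerset, ((F (S ∩ V) : ℤ) : ℂ) +
          d * ∑ S ∈ (Finset.Ico 1 (2 * q)).powerset,
            ((F (S ∩ V) * ∏ i ∈ W, descentSign i S : ℤ) : ℂ) := by
          rw [Finset.mul_sum, Finset.mul_sum, ← Finset.sum_add_distrib]
          refine Finset.sum_congr rfl fun S hS => ?_
          rw [hcd S (Finset.mem_powerset.1 hS), Int.cast_mul]
          ring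
      _ = 0 := by rw [t1, t2]; ring
  · have t3 := congrArg (Int.cast : ℤ → ℂ) s3
    have t4 := congrArg (Int.cast : ℤ → ℂ) s4
    rw [Int.cast_sum, Int.cast_zero] at t3 t4
    have hζ0 : ζ ≠ 0 := hprim.ne_zero hpos.ne'
    apply mul_left_cancel₀ hζ0
    calc ζ * Polynomial.aeval ζ (Polynomial.derivative (Q (2 * q)))
        = ∑ S ∈ (Finset.Ico 1 (2 * q)).powerset,
            beta (2 * q) S * ζ ^ beta (2 * q) S := by
          simp only [Q, map_sum, Finset.mul_sum]
          refine Finset.sum_congr rfl fun S _ => ?_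
          rw [Polynomial.derivative_X_pow]
          rcases hb : beta (2 * q) S with _ | b
          · simp
          · simp [pow_succ]
            ring
      _ = c * ∑ S ∈ (Finset.Ico 1 (2 * q)).powerset,
            ((F (S ∩ V) * beta (2 * q) S : ℤ) : ℂ) +
          d * ∑ S ∈ (Finset.Ico 1 (2 * q)).powerset,
            (((F (S ∩ V) * ∏ i ∈ W, descentSign i S) * beta (2 * q) S : ℤ) : ℂ) := by
          rw [Finset.mul_sum, Finset.mul_sum, ← Finset.sum_add_distrib]
          refine Finset.sum_congr rfl fun S hS => ?_
          rw [hcd S (Finset.mem_powerset.1 hS), Int.cast_mul, Int.cast_mul, Int.cast_mul,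
            Int.cast_natCast]
          ring
      _ = ζ * 0 := by rw [t3, t4]; ring
end
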